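/- arXiv:2506.06319 — 2 statements merged into one kernel-verified Lean document; each statement's English description precedes it below -/
import Mathlib

section
/- Fix r ∈ (0,1) and v_L ∈ [0, r). A CDF G that is an MPC of F, satisfies G(v_H) = F(v_H), and has the disclosure form with parameters (v_L, v_H, β, r) for some v_H ∈ (r, 1] and β > 0, exists if and only if E_F[v | v > v_L] > r, i.e., ∫_{v_L}^1 v f(v) dv / (1 − F(v_L)) > r. Moreover, when it exists, such a G is unique, and its slope equals β* = (E_F[F(v)^{n−1} | v ∈ (v_L, v_H)] − F(v_L)^{n−1}) / (E_F[v | v ∈ (v_L, v_H)] − r). -/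
open MeasureTheory Set Filter

/-- `G` is a mean-preserving contraction (MPC) of `F` on `[0,1]`. -/
def MPCof (G F : ℝ → ℝ) : Prop :=
  (∀ z ∈ Set.Icc (0 : ℝ) 1, 0 ≤ ∫ v in (0 : ℝ)..z, (F v - G v)) ∧
  (∫ v in (0 : ℝ)..1, (F v - G v)) = 0

/-- `G` has the disclosure form with parameters `(v_L, v_H, β, r)`:
full disclosure below `v_L`, a gap on `(v_L, r)`, the affine-in-`G^{n-1}` piece on `[r, v_H]`,
and full disclosure above `v_H`. -/
def DisclosureForm (F : ℝ → ℝ) (n : ℕ) (vL vH β r : ℝ) (G : ℝ → ℝ) : Prop :=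
  0 ≤ vL ∧ vL < r ∧ r < vH ∧ vH ≤ 1 ∧ 0 < β ∧
  (∀ v, v ≤ vL → G v = F v) ∧
  (∀ v, vL < v → v < r → G v = F vL) ∧
  (∀ v, r ≤ v → v ≤ vH →
    G v = (min (F vL ^ (n - 1) + β * (v - r)) 1) ^ (((n : ℝ) - 1)⁻¹)) ∧
  (∀ v, vH < v → v ≤ 1 → G v = F v)

theorem pow_rpow_inv_natCast_sub_one {n : ℕ} (hn : 2 ≤ n) {a : ℝ} (ha : 0 ≤ a) :
    (a ^ (n - 1)) ^ (((n : ℝ) - 1)⁻¹) = a := by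
  have h : ((n : ℝ) - 1) = ((n - 1 : ℕ) : ℝ) := by
    rw [Nat.cast_sub (by omega), Nat.cast_one]
  rw [h, Real.pow_rpow_inv_natCast ha (by omega)]

theorem rpow_inv_natCast_sub_one_pow {n : ℕ} (hn : 2 ≤ n) {y : ℝ} (hy : 0 ≤ y) :
    (y ^ (((n : ℝ) - 1)⁻¹)) ^ (n - 1) = y := by
  have h : ((n : ℝ) - 1) = ((n - 1 : ℕ) : ℝ) := by
    rw [Nat.cast_sub (by omega), Nat.cast_one]
  rw [h, Real.rpow_inv_natCast_pow hy (by omega)]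

/-- The integral of an `(n-1)`-st root of an affine function climbing from `a ^ (n-1)` to
`b ^ (n-1)`. -/
theorem mul_integral_root_affine {n : ℕ} (hn : 2 ≤ n) {a b β r s : ℝ} (ha : 0 ≤ a) (hb : 0 ≤ b)
    (h : a ^ (n - 1) + β * (s - r) = b ^ (n - 1)) :
    β * ∫ v in r..s, (a ^ (n - 1) + β * (v - r)) ^ (((n : ℝ) - 1)⁻¹) =
      ((n : ℝ) - 1) / n * (b ^ n - a ^ n) := by
  have hn0 : (0 : ℝ) < (n : ℝ) - 1 := by
    have : (2 : ℝ) ≤ n := by exact_mod_cast hn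
    linarith
  set p : ℝ := ((n : ℝ) - 1)⁻¹ with hp
  have hp0 : 0 < p := inv_pos.2 hn0
  have hpow : ∀ {y : ℝ}, 0 ≤ y → (y ^ (n - 1)) ^ (p + 1) = y ^ n := by
    intro y hy
    rw [Real.rpow_add_of_nonneg (by positivity) hp0.le zero_le_one, Real.rpow_one, hp,
      pow_rpow_inv_natCast_sub_one hn hy, ← pow_succ']
    congr 1; omega
  have hderiv : ∀ v : ℝ, HasDerivAt
      (fun v => ((n : ℝ) - 1) / n * (a ^ (n - 1) + β * (v - r)) ^ (p + 1))
      (β * (a ^ (n - 1) + β * (v - r)) ^ p) v := by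
    intro v
    have h1 : HasDerivAt (fun v => a ^ (n - 1) + β * (v - r)) β v := by
      simpa using (((hasDerivAt_id v).sub_const r).const_mul β).const_add (a ^ (n - 1))
    have h2 := (h1.rpow_const (p := p + 1) (Or.inr (by linarith))).const_mul (((n : ℝ) - 1) / n)
    convert! h2 using 1
    have h3 : ((n : ℝ) - 1) / n * (p + 1) = 1 := by
      rw [hp]; field_simp; ring
    rw [add_sub_cancel_right]
    linear_combination (-β * (a ^ (n - 1) + β * (v - r)) ^ p) * h3
  have hcont : Continuous fun v => β * (a ^ (n - 1) + β * (v - r)) ^ p :=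
    continuous_const.mul (Continuous.rpow_const (by fun_prop) fun _ => Or.inr hp0.le)
  rw [← intervalIntegral.integral_const_mul,
    intervalIntegral.integral_eq_sub_of_hasDerivAt (fun v _ => hderiv v)
      (hcont.intervalIntegrable _ _), h, hpow hb]
  simp only [sub_self, mul_zero, add_zero]
  rw [hpow ha]; ring

/-- A continuous strictly increasing CDF `F` on `[0,1]` with `F ^ (n-1)` convex. -/
structure ConvexPowCDF (F : ℝ → ℝ) (n : ℕ) : Prop where
  two_le : 2 ≤ n
  cont : ContinuousOn F (Icc 0 1)
  strictMono : StrictMonoOn F (Icc 0 1)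
  zero : F 0 = 0
  one : F 1 = 1
  convex : ConvexOn ℝ (Icc (0 : ℝ) 1) fun v => F v ^ (n - 1)

namespace ConvexPowCDF

variable {F G : ℝ → ℝ} {n : ℕ} {vL vH β r : ℝ}

theorem nonneg (hF : ConvexPowCDF F n) {v : ℝ} (h0 : 0 ≤ v) (h1 : v ≤ 1) : 0 ≤ F v :=
  hF.zero ▸ hF.strictMono.monotoneOn ⟨le_rfl, zero_le_one⟩ ⟨h0, h1⟩ h0

theorem le_one (hF : ConvexPowCDF F n) {v : ℝ} (h0 : 0 ≤ v) (h1 : v ≤ 1) : F v ≤ 1 :=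
  hF.one ▸ hF.strictMono.monotoneOn ⟨h0, h1⟩ ⟨zero_le_one, le_rfl⟩ h1

theorem lt (hF : ConvexPowCDF F n) {u v : ℝ} (h0 : 0 ≤ u) (huv : u < v) (h1 : v ≤ 1) : F u < F v :=
  hF.strictMono ⟨h0, by linarith⟩ ⟨by linarith, h1⟩ huv

theorem le (hF : ConvexPowCDF F n) {u v : ℝ} (h0 : 0 ≤ u) (huv : u ≤ v) (h1 : v ≤ 1) : F u ≤ F v :=
  hF.strictMono.monotoneOn ⟨h0, by linarith⟩ ⟨by linarith, h1⟩ huv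

theorem intervalIntegrable (hF : ConvexPowCDF F n) {a b : ℝ} (h0 : 0 ≤ a) (hab : a ≤ b)
    (h1 : b ≤ 1) : IntervalIntegrable F volume a b :=
  (hF.cont.mono (Icc_subset_Icc h0 h1)).intervalIntegrable_of_Icc hab

/-- If `F ^ (n-1)` lies below an affine function at two points, it does so in between. -/
theorem pow_le_affine (hF : ConvexPowCDF F n) {c x y z : ℝ} (hx : 0 ≤ x) (hz : z ≤ 1) (hxy : x ≤ y)
    (hyz : y ≤ z) (hFx : F x ^ (n - 1) ≤ c + β * (x - r))
    (hFz : F z ^ (n - 1) ≤ c + β * (z - r)) : F y ^ (n - 1) ≤ c + β * (y - r) := by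
  rcases hxy.eq_or_lt with rfl | hxy
  · exact hFx
  have hxz : 0 < z - x := by linarith
  have h := hF.convex.2 (⟨hx, by linarith⟩ : x ∈ Icc (0 : ℝ) 1)
    (⟨by linarith, hz⟩ : z ∈ Icc (0 : ℝ) 1)
    (div_nonneg (by linarith) hxz.le : 0 ≤ (z - y) / (z - x))
    (div_nonneg (by linarith) hxz.le : 0 ≤ (y - x) / (z - x)) (by field_simp; ring)
  have hy : (z - y) / (z - x) * x + (y - x) / (z - x) * z = y := by field_simp; ring
  simp only [smul_eq_mul, hy] at h
  have e1 := mul_le_mul_of_nonneg_left hFx (div_nonneg (by linarith) hxz.le : 0 ≤ (z - y) / (z - x))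
  have e2 := mul_le_mul_of_nonneg_left hFz (div_nonneg (by linarith) hxz.le : 0 ≤ (y - x) / (z - x))
  refine (h.trans (add_le_add e1 e2)).trans_eq ?_
  field_simp; ring

end ConvexPowCDF

namespace DisclosureForm

variable {F G : ℝ → ℝ} {n : ℕ} {vL vH β r : ℝ}

theorem eq_low (hG : DisclosureForm F n vL vH β r G) {v : ℝ} (hv : v ≤ vL) : G v = F v :=
  hG.2.2.2.2.2.1 v hv

theorem eq_gap (hG : DisclosureForm F n vL vH β r G) {v : ℝ} (h1 : vL < v) (h2 : v < r) :
    G v = F vL :=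
  hG.2.2.2.2.2.2.1 v h1 h2

theorem eq_mid (hG : DisclosureForm F n vL vH β r G) {v : ℝ} (h1 : r ≤ v) (h2 : v ≤ vH) :
    G v = (min (F vL ^ (n - 1) + β * (v - r)) 1) ^ (((n : ℝ) - 1)⁻¹) :=
  hG.2.2.2.2.2.2.2.1 v h1 h2

theorem eq_high (hG : DisclosureForm F n vL vH β r G) (ht : G vH = F vH) {v : ℝ} (h1 : vH ≤ v)
    (h2 : v ≤ 1) : G v = F v := by
  rcases h1.eq_or_lt with rfl | h1
  · exact ht
  · exact hG.2.2.2.2.2.2.2.2 v h1 h2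

theorem min_nonneg (hG : DisclosureForm F n vL vH β r G) (hF : ConvexPowCDF F n) {v : ℝ}
    (h1 : r ≤ v) : 0 ≤ min (F vL ^ (n - 1) + β * (v - r)) 1 := by
  obtain ⟨h0, hr, hrH, hH, hβ, -⟩ := hG
  have := hF.nonneg h0 (by linarith)
  exact le_min (add_nonneg (by positivity) (mul_nonneg hβ.le (by linarith))) zero_le_one

theorem mid_nonneg (hG : DisclosureForm F n vL vH β r G) (hF : ConvexPowCDF F n) {v : ℝ}
    (h1 : r ≤ v) (h2 : v ≤ vH) : 0 ≤ G v :=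
  hG.eq_mid h1 h2 ▸ Real.rpow_nonneg (hG.min_nonneg hF h1) _

theorem mid_pow (hG : DisclosureForm F n vL vH β r G) (hF : ConvexPowCDF F n) {v : ℝ}
    (h1 : r ≤ v) (h2 : v ≤ vH) : G v ^ (n - 1) = min (F vL ^ (n - 1) + β * (v - r)) 1 := by
  rw [hG.eq_mid h1 h2, rpow_inv_natCast_sub_one_pow hF.two_le (hG.min_nonneg hF h1)]

theorem le_mid_iff (hG : DisclosureForm F n vL vH β r G) (hF : ConvexPowCDF F n) {v : ℝ}
    (h1 : r ≤ v) (h2 : v ≤ vH) : F v ≤ G v ↔ F v ^ (n - 1) ≤ F vL ^ (n - 1) + β * (v - r) := by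
  have hn := hF.two_le
  have h0 : 0 ≤ v := hG.1.trans (hG.2.1.le.trans h1)
  have h3 : v ≤ 1 := h2.trans hG.2.2.2.1
  rw [← pow_le_pow_iff_left₀ (hF.nonneg h0 h3) (hG.mid_nonneg hF h1 h2)
    (by omega : n - 1 ≠ 0), hG.mid_pow hF h1 h2, le_min_iff]
  exact and_iff_left (pow_le_one₀ (hF.nonneg h0 h3) (hF.le_one h0 h3))

theorem touch_pow (hG : DisclosureForm F n vL vH β r G) (hF : ConvexPowCDF F n)
    (ht : G vH = F vH) : F vH ^ (n - 1) = min (F vL ^ (n - 1) + β * (vH - r)) 1 := by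
  rw [← ht, hG.mid_pow hF hG.2.2.1.le le_rfl]

theorem continuousOn (hG : DisclosureForm F n vL vH β r G) (hF : ConvexPowCDF F n)
    (ht : G vH = F vH) : ContinuousOn G (Icc r 1) := by
  have hn : (2 : ℝ) ≤ n := by exact_mod_cast hF.two_le
  rw [← Icc_union_Icc_eq_Icc hG.2.2.1.le hG.2.2.2.1]
  refine ContinuousOn.union_of_isClosed ?_ ?_ isClosed_Icc isClosed_Icc
  · have : Continuous fun v => (min (F vL ^ (n - 1) + β * (v - r)) 1) ^ (((n : ℝ) - 1)⁻¹) :=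
      Continuous.rpow_const (by fun_prop) fun _ => Or.inr (inv_nonneg.2 (by linarith))
    exact this.continuousOn.congr fun v hv => hG.eq_mid hv.1 hv.2
  · refine (hF.cont.mono (Icc_subset_Icc_left ?_)).congr fun v hv => hG.eq_high ht hv.1 hv.2
    linarith [hG.1, hG.2.1, hG.2.2.1]

theorem intervalIntegrable_right (hG : DisclosureForm F n vL vH β r G) (hF : ConvexPowCDF F n)
    (ht : G vH = F vH) {a b : ℝ} (ha : r ≤ a) (hab : a ≤ b) (hb : b ≤ 1) :
    IntervalIntegrable G volume a b :=
  ((hG.continuousOn hF ht).mono (Icc_subset_Icc ha hb)).intervalIntegrable_of_Icc hab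

theorem intervalIntegrable_low (hG : DisclosureForm F n vL vH β r G) (hF : ConvexPowCDF F n) :
    IntervalIntegrable G volume 0 vL := by
  obtain ⟨h0, hr, hrH, hH, -⟩ := id hG
  refine (hF.intervalIntegrable le_rfl h0 (by linarith)).congr_uIoo fun v hv => ?_
  rw [uIoo_of_le h0] at hv
  exact (hG.eq_low hv.2.le).symm

theorem intervalIntegrable_gap (hG : DisclosureForm F n vL vH β r G) :
    IntervalIntegrable G volume vL r := by
  refine (intervalIntegrable_const (c := F vL)).congr_uIoo fun v hv => ?_
  rw [uIoo_of_le hG.2.1.le] at hv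
  exact (hG.eq_gap hv.1 hv.2).symm

theorem intervalIntegrable (hG : DisclosureForm F n vL vH β r G) (hF : ConvexPowCDF F n)
    (ht : G vH = F vH) : IntervalIntegrable G volume 0 1 :=
  ((hG.intervalIntegrable_low hF).trans hG.intervalIntegrable_gap).trans
    (hG.intervalIntegrable_right hF ht le_rfl (hG.2.2.1.le.trans hG.2.2.2.1) le_rfl)

theorem integral_sub (hG : DisclosureForm F n vL vH β r G) (hF : ConvexPowCDF F n)
    (ht : G vH = F vH) : ∫ v in (0 : ℝ)..1, (F v - G v) =
      (∫ v in vL..vH, F v) - F vL * (r - vL) - ∫ v in r..vH, G v := by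
  obtain ⟨h0, hr, hrH, hH, -⟩ := id hG
  have iF := @hF.intervalIntegrable
  rw [intervalIntegral.integral_sub (iF le_rfl zero_le_one le_rfl) (hG.intervalIntegrable hF ht),
    ← intervalIntegral.integral_add_adjacent_intervals (iF le_rfl h0 (by linarith))
      (iF h0 (by linarith) le_rfl),
    ← intervalIntegral.integral_add_adjacent_intervals (iF h0 (by linarith) hH)
      (iF (by linarith) hH le_rfl),
    ← intervalIntegral.integral_add_adjacent_intervals (hG.intervalIntegrable_low hF)
      (hG.intervalIntegrable_gap.trans
        (hG.intervalIntegrable_right hF ht le_rfl (by linarith) le_rfl)),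
    ← intervalIntegral.integral_add_adjacent_intervals hG.intervalIntegrable_gap
        (hG.intervalIntegrable_right hF ht le_rfl (by linarith) le_rfl),
    ← intervalIntegral.integral_add_adjacent_intervals
      (hG.intervalIntegrable_right hF ht le_rfl hrH.le hH)
      (hG.intervalIntegrable_right hF ht hrH.le hH le_rfl),
    intervalIntegral.integral_congr_Ioo_of_le (f := G) (g := F) h0
      fun v hv => hG.eq_low hv.2.le,
    intervalIntegral.integral_congr_Ioo_of_le (f := G) (g := F) hH
      fun v hv => hG.eq_high ht hv.1.le hv.2.le,
    intervalIntegral.integral_congr_Ioo_of_le (f := G) (g := fun _ => F vL) hr.le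
      fun v hv => hG.eq_gap hv.1 hv.2,
    intervalIntegral.integral_const, smul_eq_mul]
  ring

/-- The integral of `G` over the affine piece, which stops climbing at `s`. -/
theorem mul_integral_mid (hG : DisclosureForm F n vL vH β r G) (hF : ConvexPowCDF F n)
    (ht : G vH = F vH) : β * ∫ v in r..vH, G v =
      ((n : ℝ) - 1) / n * (F vH ^ n - F vL ^ n) +
        (β * (vH - r) - (F vH ^ (n - 1) - F vL ^ (n - 1))) * F vH := by
  obtain ⟨h0, hr, hrH, hH, hβ, -⟩ := id hG
  have ha := hF.nonneg h0 (by linarith)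
  have hb := hF.nonneg (by linarith) hH
  have hb1 := hF.le_one (by linarith) hH
  have hab : F vL ^ (n - 1) ≤ F vH ^ (n - 1) :=
    pow_le_pow_left₀ ha (hF.le h0 (by linarith) hH) _
  have htp := hG.touch_pow hF ht
  obtain ⟨s, hs⟩ : ∃ s, F vL ^ (n - 1) + β * (s - r) = F vH ^ (n - 1) :=
    ⟨r + (F vH ^ (n - 1) - F vL ^ (n - 1)) / β, by field_simp; ring⟩
  have hrs : r ≤ s := by nlinarith
  have hsH : s ≤ vH := by
    have := htp.trans_le (min_le_left _ _)
    nlinarith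
  have hI1 : ∫ v in r..s, G v =
      ∫ v in r..s, (F vL ^ (n - 1) + β * (v - r)) ^ (((n : ℝ) - 1)⁻¹) := by
    refine intervalIntegral.integral_congr_Ioo_of_le hrs fun v hv => ?_
    have hle : F vL ^ (n - 1) + β * (v - r) ≤ 1 := by
      have := htp.trans_le (min_le_right _ _)
      nlinarith [hv.2]
    simp only [hG.eq_mid hv.1.le (hv.2.le.trans hsH), min_eq_left hle]
  have hI2 : ∫ v in s..vH, G v = (vH - s) * F vH := by
    rw [intervalIntegral.integral_congr_Ioo_of_le (f := G) (g := fun _ => F vH) hsH,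
      intervalIntegral.integral_const, smul_eq_mul]
    intro v hv
    have hmid := hG.eq_mid (hrs.trans hv.1.le) hv.2.le
    have : min (F vL ^ (n - 1) + β * (v - r)) 1 = F vH ^ (n - 1) := by
      apply le_antisymm
      · rw [htp]
        exact min_le_min_right _ (by nlinarith [hv.2])
      · exact le_min (by nlinarith [hv.1]) (pow_le_one₀ hb hb1)
    rw [this, pow_rpow_inv_natCast_sub_one hF.two_le hb] at hmid
    exact hmid
  rw [← intervalIntegral.integral_add_adjacent_intervals
    (hG.intervalIntegrable_right hF ht le_rfl hrs (hsH.trans hH))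
    (hG.intervalIntegrable_right hF ht hrs hsH hH), mul_add, hI1, hI2,
    mul_integral_root_affine hF.two_le ha hb hs]
  linear_combination (-F vH) * hs

theorem gap_lt_integral (hG : DisclosureForm F n vL vH β r G) (hF : ConvexPowCDF F n) :
    F vL * (r - vL) < ∫ v in vL..r, F v := by
  obtain ⟨h0, hr, hrH, hH, -⟩ := hG
  have := intervalIntegral.integral_lt_integral_of_continuousOn_of_le_of_exists_lt
    (f := fun _ => F vL) (g := F) hr continuousOn_const
    (hF.cont.mono (Icc_subset_Icc h0 (by linarith)))
    (fun v hv => hF.le h0 hv.1.le (by linarith [hv.2]))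
    ⟨r, ⟨hr.le, le_rfl⟩, hF.lt h0 hr (by linarith)⟩
  rw [intervalIntegral.integral_const, smul_eq_mul] at this
  linarith

theorem mid_le (hG : DisclosureForm F n vL vH β r G) (hF : ConvexPowCDF F n)
    (ht : G vH = F vH) {v : ℝ} (h1 : r ≤ v) (h2 : v ≤ vH) : G v ≤ F vH := by
  have hn := hF.two_le
  have h0 : 0 ≤ vH := hG.1.trans (hG.2.1.le.trans hG.2.2.1.le)
  rw [← pow_le_pow_iff_left₀ (hG.mid_nonneg hF h1 h2) (hF.nonneg h0 hG.2.2.2.1)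
    (by omega : n - 1 ≠ 0), hG.mid_pow hF h1 h2, hG.touch_pow hF ht]
  have := mul_le_mul_of_nonneg_left (sub_le_sub_right h2 r) hG.2.2.2.2.1.le
  exact min_le_min_right _ (by linarith)

theorem eq_at_reserve (hG : DisclosureForm F n vL vH β r G) (hF : ConvexPowCDF F n) :
    G r = F vL := by
  obtain ⟨h0, hr, hrH, hH, -⟩ := id hG
  have ha := hF.nonneg h0 (by linarith)
  rw [hG.eq_mid le_rfl hrH.le, sub_self, mul_zero, add_zero,
    min_eq_left (pow_le_one₀ ha (hF.le_one h0 (by linarith))),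
    pow_rpow_inv_natCast_sub_one hF.two_le ha]

theorem integral_mid_lt (hG : DisclosureForm F n vL vH β r G) (hF : ConvexPowCDF F n)
    (ht : G vH = F vH) : ∫ v in r..vH, G v < F vH * (vH - r) := by
  obtain ⟨h0, hr, hrH, hH, -⟩ := id hG
  have := intervalIntegral.integral_lt_integral_of_continuousOn_of_le_of_exists_lt
    (f := G) (g := fun _ => F vH) hrH
    ((hG.continuousOn hF ht).mono (Icc_subset_Icc_right hH)) continuousOn_const
    (fun v hv => hG.mid_le hF ht hv.1.le hv.2)
    ⟨r, ⟨le_rfl, hrH.le⟩, by rw [hG.eq_at_reserve hF]; exact hF.lt h0 (by linarith) hH⟩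
  rw [intervalIntegral.integral_const, smul_eq_mul] at this
  linarith

/-- Past the touching point, `F ^ (n-1)` lies above the affine function. -/
theorem affine_le_high (hG : DisclosureForm F n vL vH β r G) (hF : ConvexPowCDF F n)
    (ht : G vH = F vH) (hM : ∫ v in (0 : ℝ)..1, (F v - G v) = 0) {v : ℝ} (h1 : vH < v)
    (h2 : v ≤ 1) : F vL ^ (n - 1) + β * (v - r) ≤ F v ^ (n - 1) := by
  have hn := hF.two_le
  obtain ⟨h0, hr, hrH, hH, hβ, -⟩ := id hG
  obtain ⟨x, hx, hxG⟩ : ∃ x ∈ Ioo r vH, F x < G x := by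
    by_contra! hcon
    have hle := intervalIntegral.integral_mono_on_of_le_Ioo hrH.le
      (hG.intervalIntegrable_right hF ht le_rfl hrH.le hH)
      (hF.intervalIntegrable (by linarith) hrH.le hH) hcon
    have hgap := hG.gap_lt_integral hF
    rw [hG.integral_sub hF ht, ← intervalIntegral.integral_add_adjacent_intervals
      (hF.intervalIntegrable h0 hr.le (by linarith))
      (hF.intervalIntegrable (by linarith) hrH.le hH)] at hM
    linarith
  by_contra! hlt
  have hxpow : F x ^ (n - 1) < F vL ^ (n - 1) + β * (x - r) := by
    have := pow_lt_pow_left₀ hxG (hF.nonneg (by linarith [hx.1]) (by linarith [hx.2]))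
      (by omega : n - 1 ≠ 0)
    exact this.trans_le ((hG.mid_pow hF hx.1.le hx.2.le).trans_le (min_le_left _ _))
  have hpow1 : F vH ^ (n - 1) < 1 := by
    have hlt1 := hF.lt (by linarith) h1 h2
    exact pow_lt_one₀ (hF.nonneg (by linarith) hH)
      (hlt1.trans_le (hF.le_one (by linarith) h2)) (by omega)
  have htp := hG.touch_pow hF ht
  have htp' : F vH ^ (n - 1) = F vL ^ (n - 1) + β * (vH - r) := by
    rcases min_choice (F vL ^ (n - 1) + β * (vH - r)) 1 with h | h
    · rw [htp, h]
    · rw [htp, h] at hpow1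
      exact absurd hpow1 (lt_irrefl _)
  obtain ⟨ε, hε, hεx, hεv⟩ : ∃ ε > 0, F x ^ (n - 1) ≤ F vL ^ (n - 1) - ε + β * (x - r) ∧
      F v ^ (n - 1) ≤ F vL ^ (n - 1) - ε + β * (v - r) :=
    ⟨min (F vL ^ (n - 1) + β * (x - r) - F x ^ (n - 1))
        (F vL ^ (n - 1) + β * (v - r) - F v ^ (n - 1)),
      lt_min (by linarith) (by linarith), by
        linarith [min_le_left (F vL ^ (n - 1) + β * (x - r) - F x ^ (n - 1))
          (F vL ^ (n - 1) + β * (v - r) - F v ^ (n - 1))], by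
        linarith [min_le_right (F vL ^ (n - 1) + β * (x - r) - F x ^ (n - 1))
          (F vL ^ (n - 1) + β * (v - r) - F v ^ (n - 1))]⟩
  have := hF.pow_le_affine (by linarith [hx.1]) h2 hx.2.le h1.le hεx hεv
  linarith

/-- A disclosure form with the mean of `F` which touches `F` at `vH` is an MPC of `F`. -/
theorem mpcOf (hG : DisclosureForm F n vL vH β r G) (hF : ConvexPowCDF F n)
    (ht : G vH = F vH) (hM : ∫ v in (0 : ℝ)..1, (F v - G v) = 0) : MPCof G F := by
  refine ⟨fun z hz => ?_, hM⟩
  obtain ⟨h0, hr, hrH, hH, hβ, -⟩ := id hG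
  have hint : ∀ {a b : ℝ}, 0 ≤ a → a ≤ b → b ≤ 1 →
      IntervalIntegrable (fun v => F v - G v) volume a b := by
    intro a b ha hab hb
    refine ((hF.intervalIntegrable le_rfl zero_le_one le_rfl).sub
      (hG.intervalIntegrable hF ht)).mono_set ?_
    rw [uIcc_of_le hab, uIcc_of_le zero_le_one]
    exact Icc_subset_Icc ha hb
  have hend : F vH ^ (n - 1) ≤ F vL ^ (n - 1) + β * (vH - r) :=
    (hG.touch_pow hF ht).trans_le (min_le_left _ _)
  by_cases hcase : r ≤ z ∧ F z ≤ G z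
  · have htail : ∫ v in z..1, (F v - G v) ≤ ∫ v in z..1, (0 : ℝ) := by
      refine intervalIntegral.integral_mono_on hz.2 (hint hz.1 hz.2 le_rfl)
        intervalIntegrable_const fun v hv => sub_nonpos.2 ?_
      rcases le_total vH v with h | h
      · exact (hG.eq_high ht h hv.2).ge
      · exact (hG.le_mid_iff hF (hcase.1.trans hv.1) h).2 (hF.pow_le_affine hz.1 hH hv.1 h
          ((hG.le_mid_iff hF hcase.1 (hv.1.trans h)).1 hcase.2) hend)
    have hsum := intervalIntegral.integral_add_adjacent_intervals (hint le_rfl hz.1 hz.2)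
      (hint hz.1 hz.2 le_rfl)
    rw [intervalIntegral.integral_zero] at htail
    linarith
  · refine intervalIntegral.integral_nonneg hz.1 fun v hv => sub_nonneg.2 ?_
    rcases le_or_gt v vL with h | h
    · exact (hG.eq_low h).le
    rcases lt_or_ge v r with h' | h'
    · exact (hG.eq_gap h h').trans_le (hF.le h0 h.le (by linarith))
    have hlt : G z < F z := not_le.1 fun hle => hcase ⟨h'.trans hv.2, hle⟩
    have hzH : z < vH := not_le.1 fun hle => hlt.ne (hG.eq_high ht hle hz.2)
    by_contra! hcon
    refine hlt.not_ge ((hG.le_mid_iff hF (h'.trans hv.2) hzH.le).2 ?_)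
    exact hF.pow_le_affine hv.1 hH hv.2 hzH.le
      ((hG.le_mid_iff hF h' (hv.2.trans hzH.le)).1 hcon.le) hend

/-- Two disclosure forms with the mean of `F` and ordered parameters coincide. -/
theorem eqOn_of_le {G' : ℝ → ℝ} {vH' β' : ℝ} (hF : ConvexPowCDF F n)
    (hG : DisclosureForm F n vL vH β r G) (ht : G vH = F vH)
    (hM : ∫ v in (0 : ℝ)..1, (F v - G v) = 0)
    (hG' : DisclosureForm F n vL vH' β' r G') (ht' : G' vH' = F vH')
    (hM' : ∫ v in (0 : ℝ)..1, (F v - G' v) = 0) (hββ : β ≤ β') (hHH : vH ≤ vH') :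
    EqOn G G' (Icc 0 1) := by
  have hn := hF.two_le
  obtain ⟨h0, hr, hrH, hH, hβ, -⟩ := id hG
  have hrH' := hG'.2.2.1
  have hH' := hG'.2.2.2.1
  have hmono : ∀ {v : ℝ}, r ≤ v → F vL ^ (n - 1) + β * (v - r) ≤ F vL ^ (n - 1) + β' * (v - r) :=
    fun hv => by
      have := mul_le_mul_of_nonneg_right hββ (sub_nonneg.2 hv)
      linarith
  have hlow : ∀ {v : ℝ}, v < r → G v = G' v := fun {v} hv => by
    rcases le_or_gt v vL with h | h
    · rw [hG.eq_low h, hG'.eq_low h]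
    · rw [hG.eq_gap h hv, hG'.eq_gap h hv]
  have hle : ∀ {v : ℝ}, r ≤ v → v ≤ 1 → G v ≤ G' v := fun {v} h1 h2 => by
    rcases le_total v vH with h | h
    · rw [← pow_le_pow_iff_left₀ (hG.mid_nonneg hF h1 h) (hG'.mid_nonneg hF h1 (h.trans hHH))
        (by omega : n - 1 ≠ 0), hG.mid_pow hF h1 h, hG'.mid_pow hF h1 (h.trans hHH)]
      exact min_le_min_right _ (hmono h1)
    · rw [hG.eq_high ht h h2]
      rcases le_total v vH' with h' | h'
      · refine (hG'.le_mid_iff hF h1 h').2 (hF.pow_le_affine (by linarith) hH' h h' ?_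
          ((hG'.touch_pow hF ht').trans_le (min_le_left _ _)))
        exact ((hG.touch_pow hF ht).trans_le (min_le_left _ _)).trans (hmono hrH.le)
      · exact (hG'.eq_high ht' h' h2).ge
  have hr1 : r < 1 := hrH.trans_le hH
  have hint : ∫ v in r..1, G v = ∫ v in r..1, G' v := by
    have hi := intervalIntegral.integral_sub
      (hF.intervalIntegrable le_rfl zero_le_one le_rfl) (hG.intervalIntegrable hF ht)
    have hi' := intervalIntegral.integral_sub
      (hF.intervalIntegrable le_rfl zero_le_one le_rfl) (hG'.intervalIntegrable hF ht')
    rw [← intervalIntegral.integral_add_adjacent_intervals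
      ((hG.intervalIntegrable_low hF).trans hG.intervalIntegrable_gap)
      (hG.intervalIntegrable_right hF ht le_rfl hr1.le le_rfl)] at hi
    rw [← intervalIntegral.integral_add_adjacent_intervals
      ((hG'.intervalIntegrable_low hF).trans hG'.intervalIntegrable_gap)
      (hG'.intervalIntegrable_right hF ht' le_rfl hr1.le le_rfl),
      ← intervalIntegral.integral_congr_Ioo_of_le (f := G) (g := G') (h0.trans hr.le)
        fun v hv => hlow hv.2] at hi'
    linarith
  intro v hv
  rcases lt_or_ge v r with h | h
  · exact hlow h
  refine (hle h hv.2).antisymm (not_lt.1 fun hlt => hint.not_lt ?_)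
  exact intervalIntegral.integral_lt_integral_of_continuousOn_of_le_of_exists_lt hr1
    (hG.continuousOn hF ht) (hG'.continuousOn hF ht') (fun x hx => hle hx.1.le hx.2)
    ⟨v, ⟨h, hv.2⟩, hlt⟩

theorem vH_le_of_lt {G' : ℝ → ℝ} {vH' β' : ℝ} (hF : ConvexPowCDF F n)
    (hG : DisclosureForm F n vL vH β r G) (ht : G vH = F vH)
    (hG' : DisclosureForm F n vL vH' β' r G') (ht' : G' vH' = F vH')
    (hM' : ∫ v in (0 : ℝ)..1, (F v - G' v) = 0) (hββ : β < β') : vH ≤ vH' := by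
  by_contra! hlt
  have h1 := hG'.affine_le_high hF ht' hM' hlt hG.2.2.2.1
  have h2 := (hG.touch_pow hF ht).trans_le (min_le_left _ _)
  have h3 := mul_lt_mul_of_pos_right hββ (sub_pos.2 hG.2.2.1)
  linarith

theorem eqOn {G' : ℝ → ℝ} {vH' β' : ℝ} (hF : ConvexPowCDF F n)
    (hG : DisclosureForm F n vL vH β r G) (ht : G vH = F vH)
    (hM : ∫ v in (0 : ℝ)..1, (F v - G v) = 0)
    (hG' : DisclosureForm F n vL vH' β' r G') (ht' : G' vH' = F vH')
    (hM' : ∫ v in (0 : ℝ)..1, (F v - G' v) = 0) : EqOn G G' (Icc 0 1) := by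
  rcases lt_trichotomy β β' with h | rfl | h
  · exact eqOn_of_le hF hG ht hM hG' ht' hM' h.le (vH_le_of_lt hF hG ht hG' ht' hM' h)
  · rcases le_total vH vH' with h | h
    · exact eqOn_of_le hF hG ht hM hG' ht' hM' le_rfl h
    · exact (eqOn_of_le hF hG' ht' hM' hG ht hM le_rfl h).symm
  · exact (eqOn_of_le hF hG' ht' hM' hG ht hM h.le (vH_le_of_lt hF hG' ht' hG ht hM h)).symm

end DisclosureForm

section Density

variable {F f : ℝ → ℝ} {a b : ℝ}

theorem hasDerivAt_of_eq_integral (hf : ContinuousOn f (Icc 0 1))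
    (hF : ∀ z ∈ Icc (0 : ℝ) 1, F z = ∫ t in (0 : ℝ)..z, f t) {x : ℝ} (hx : x ∈ Ioo (0 : ℝ) 1) :
    HasDerivAt F (f x) x := by
  have hnhds : Icc (0 : ℝ) 1 ∈ nhds x := Icc_mem_nhds hx.1 hx.2
  have h := intervalIntegral.integral_hasDerivAt_right
    ((hf.mono (Icc_subset_Icc_right hx.2.le)).intervalIntegrable_of_Icc hx.1.le)
    ((hf.mono Ioo_subset_Icc_self).stronglyMeasurableAtFilter isOpen_Ioo x hx)
    (hf.continuousAt hnhds)
  exact h.congr_of_eventuallyEq (eventually_of_mem hnhds hF)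

theorem continuousOn_of_eq_integral (hf : ContinuousOn f (Icc 0 1))
    (hF : ∀ z ∈ Icc (0 : ℝ) 1, F z = ∫ t in (0 : ℝ)..z, f t) : ContinuousOn F (Icc 0 1) := by
  have h := intervalIntegral.continuousOn_primitive_interval (a := 0) (b := 1) (f := f)
    (μ := volume) (by rw [uIcc_of_le zero_le_one]; exact hf.integrableOn_Icc)
  rw [uIcc_of_le zero_le_one] at h
  exact h.congr hF

theorem ConvexPowCDF.of_density {n : ℕ} (hf : ContinuousOn f (Icc 0 1))
    (hpos : ∀ v ∈ Icc (0 : ℝ) 1, 0 < f v)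
    (hF : ∀ z ∈ Icc (0 : ℝ) 1, F z = ∫ t in (0 : ℝ)..z, f t) (hF1 : F 1 = 1) (hn : 2 ≤ n)
    (hconv : ConvexOn ℝ (Icc (0 : ℝ) 1) fun v => F v ^ (n - 1)) : ConvexPowCDF F n where
  two_le := hn
  cont := continuousOn_of_eq_integral hf hF
  strictMono := by
    refine strictMonoOn_of_deriv_pos (convex_Icc _ _) (continuousOn_of_eq_integral hf hF) ?_
    intro x hx
    rw [interior_Icc] at hx
    rw [(hasDerivAt_of_eq_integral hf hF hx).deriv]
    exact hpos x (Ioo_subset_Icc_self hx)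
  zero := by rw [hF 0 ⟨le_rfl, zero_le_one⟩, intervalIntegral.integral_same]
  one := hF1
  convex := hconv

theorem integral_id_mul_density (hf : ContinuousOn f (Icc 0 1))
    (hF : ∀ z ∈ Icc (0 : ℝ) 1, F z = ∫ t in (0 : ℝ)..z, f t) (h0 : 0 ≤ a) (hab : a ≤ b)
    (h1 : b ≤ 1) : ∫ v in a..b, v * f v = b * F b - a * F a - ∫ v in a..b, F v := by
  have hsub := Icc_subset_Icc h0 h1
  have hFc := (continuousOn_of_eq_integral hf hF).mono hsub
  have hiF := hFc.intervalIntegrable_of_Icc (μ := volume) hab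
  have hif := (continuousOn_id.mul (hf.mono hsub)).intervalIntegrable_of_Icc (μ := volume) hab
  have h := intervalIntegral.integral_eq_sub_of_hasDerivAt_of_le hab
    (continuousOn_id.mul hFc) (fun x hx => (hasDerivAt_id x).mul
      (hasDerivAt_of_eq_integral hf hF ⟨h0.trans_lt hx.1, hx.2.trans_le h1⟩))
    ((hiF.add hif).congr fun x _ => by simp)
  have h' := intervalIntegral.integral_add hiF hif
  simp only [id_eq, one_mul, Pi.mul_apply] at h h'
  linarith

theorem integral_pow_mul_density {n : ℕ} (hn : 2 ≤ n) (hf : ContinuousOn f (Icc 0 1))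
    (hF : ∀ z ∈ Icc (0 : ℝ) 1, F z = ∫ t in (0 : ℝ)..z, f t) (h0 : 0 ≤ a) (hab : a ≤ b)
    (h1 : b ≤ 1) : ∫ v in a..b, F v ^ (n - 1) * f v = (F b ^ n - F a ^ n) / n := by
  have hn0 : (n : ℝ) ≠ 0 := by positivity
  have hsub := Icc_subset_Icc h0 h1
  have hFc := (continuousOn_of_eq_integral hf hF).mono hsub
  have hint := ((hFc.pow (n - 1)).mul (hf.mono hsub)).intervalIntegrable_of_Icc (μ := volume) hab
  have h := intervalIntegral.integral_eq_sub_of_hasDerivAt_of_le hab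
    ((hFc.pow n).div_const n) (fun x hx => ((hasDerivAt_of_eq_integral hf hF
      ⟨h0.trans_lt hx.1, hx.2.trans_le h1⟩).pow n).div_const n)
    (hint.congr fun x _ => by simp; field_simp)
  rw [sub_div]
  simp only [Pi.pow_apply] at h
  rw [← h]
  refine intervalIntegral.integral_congr fun x _ => ?_
  field_simp

end Density

/-- The distribution with the disclosure form of parameters `(vL, vH, β, r)`. -/
noncomputable def disclosureCDF (F : ℝ → ℝ) (n : ℕ) (vL vH β r : ℝ) (v : ℝ) : ℝ :=
  if v ≤ vL then F v
  else if v < r then F vL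
  else if v ≤ vH then (min (F vL ^ (n - 1) + β * (v - r)) 1) ^ (((n : ℝ) - 1)⁻¹)
  else F v

theorem disclosureForm_disclosureCDF {F : ℝ → ℝ} {n : ℕ} {vL vH β r : ℝ} (h0 : 0 ≤ vL)
    (hr : vL < r) (hrH : r < vH) (hH : vH ≤ 1) (hβ : 0 < β) :
    DisclosureForm F n vL vH β r (disclosureCDF F n vL vH β r) := by
  refine ⟨h0, hr, hrH, hH, hβ, fun v hv => ?_, fun v h1 h2 => ?_, fun v h1 h2 => ?_,
    fun v h1 _ => ?_⟩ <;> unfold disclosureCDF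
  · rw [if_pos hv]
  · rw [if_neg h1.not_ge, if_pos h2]
  · rw [if_neg (hr.trans_le h1).not_ge, if_neg h1.not_gt, if_pos h2]
  · rw [if_neg ((hr.trans hrH).trans h1).not_ge, if_neg (hrH.trans h1).not_gt, if_neg h1.not_ge]

/-- It suffices to solve the mean equation for the point `s` where the affine piece reaches
`F vH ^ (n-1)`. -/
theorem ConvexPowCDF.exists_disclosureForm {F : ℝ → ℝ} {n : ℕ} {vL vH r s : ℝ}
    (hF : ConvexPowCDF F n) (h0 : 0 ≤ vL) (hr : vL < r) (hrs : r < s) (hsH : s ≤ vH) (hH : vH ≤ 1)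
    (hs : s = vH ∨ vH = 1)
    (hM : (∫ v in vL..vH, F v) - F vL * (r - vL) - ((s - r) * (((n : ℝ) - 1) / n *
      (F vH ^ n - F vL ^ n) / (F vH ^ (n - 1) - F vL ^ (n - 1))) + (vH - s) * F vH) = 0) :
    ∃ G : ℝ → ℝ, ∃ vH β : ℝ, MPCof G F ∧ G vH = F vH ∧ DisclosureForm F n vL vH β r G := by
  have hn := hF.two_le
  have ha := hF.nonneg h0 (by linarith)
  have hb := hF.nonneg (by linarith) hH
  have hb1 := hF.le_one (by linarith) hH
  have hd : 0 < F vH ^ (n - 1) - F vL ^ (n - 1) :=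
    sub_pos.2 (pow_lt_pow_left₀ (hF.lt h0 (by linarith) hH) ha (by omega))
  have hsr : 0 < s - r := sub_pos.2 hrs
  set β := (F vH ^ (n - 1) - F vL ^ (n - 1)) / (s - r) with hβ_def
  have hβ : 0 < β := div_pos hd hsr
  have hβs : β * (s - r) = F vH ^ (n - 1) - F vL ^ (n - 1) := div_mul_cancel₀ _ hsr.ne'
  have hG := disclosureForm_disclosureCDF (F := F) (n := n) h0 hr (hrs.trans_le hsH) hH hβ
  have htouch : disclosureCDF F n vL vH β r vH = F vH := by
    rw [hG.eq_mid (by linarith) le_rfl]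
    have : min (F vL ^ (n - 1) + β * (vH - r)) 1 = F vH ^ (n - 1) := by
      rcases hs with rfl | rfl
      · rw [hβs, add_sub_cancel, min_eq_left (pow_le_one₀ hb hb1)]
      · rw [hF.one, one_pow] at hβs ⊢
        exact min_eq_right (by nlinarith)
    rw [this, pow_rpow_inv_natCast_sub_one hn hb]
  refine ⟨_, vH, β, hG.mpcOf hF htouch ?_, htouch, hG⟩
  rw [hG.integral_sub hF htouch, ← hM]
  congr 1
  have h := hG.mul_integral_mid hF htouch
  refine mul_left_cancel₀ hβ.ne' (h.trans ?_)
  have hK : β * ((s - r) * (((n : ℝ) - 1) / n * (F vH ^ n - F vL ^ n) /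
      (F vH ^ (n - 1) - F vL ^ (n - 1)))) = ((n : ℝ) - 1) / n * (F vH ^ n - F vL ^ n) := by
    rw [← mul_assoc, hβs, mul_div_cancel₀ _ hd.ne']
  rw [mul_add, hK]
  linear_combination (F vH) * hβs

theorem ConvexPowCDF.exists_disclosureForm_of_integral_lt {F : ℝ → ℝ} {n : ℕ} {vL r : ℝ}
    (hF : ConvexPowCDF F n) (h0 : 0 ≤ vL) (hr : vL < r) (hr1 : r < 1)
    (hlt : ∫ v in vL..1, F v < F vL * (r - vL) + (1 - r)) :
    ∃ G : ℝ → ℝ, ∃ vH β : ℝ, MPCof G F ∧ G vH = F vH ∧ DisclosureForm F n vL vH β r G := by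
  have hn := hF.two_le
  have ha := hF.nonneg h0 (by linarith)
  set D : ℝ → ℝ := fun w => (∫ v in vL..w, F v) - F vL * (r - vL) - (w - r) *
    (((n : ℝ) - 1) / n * (F w ^ n - F vL ^ n) / (F w ^ (n - 1) - F vL ^ (n - 1))) with hD
  have hDr : 0 < D r := by
    have := (disclosureForm_disclosureCDF (F := F) (n := n) h0 hr hr1 le_rfl
      one_pos).gap_lt_integral hF
    simp only [hD, sub_self, zero_mul, sub_zero]
    linarith
  rcases le_or_gt (D 1) 0 with hD1 | hD1
  · have hc : ContinuousOn D (Icc r 1) := by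
      have hFc := hF.cont.mono (Icc_subset_Icc_left (b := 1) (h0.trans hr.le))
      have hP : ContinuousOn (fun w => ∫ v in vL..w, F v) (Icc r 1) := by
        have h := intervalIntegral.continuousOn_primitive_interval (a := vL) (b := 1) (f := F)
          (μ := volume) (by
            rw [uIcc_of_le (by linarith)]
            exact (hF.cont.mono (Icc_subset_Icc_left h0)).integrableOn_Icc)
        rw [uIcc_of_le (by linarith)] at h
        exact h.mono (Icc_subset_Icc_left hr.le)
      refine (hP.sub continuousOn_const).sub ((continuousOn_id.sub continuousOn_const).mul
        ((continuousOn_const.mul ((hFc.pow _).sub continuousOn_const)).div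
          ((hFc.pow _).sub continuousOn_const) fun w hw => ?_))
      exact (sub_pos.2 (pow_lt_pow_left₀ (hF.lt h0 (hr.trans_le hw.1) hw.2) ha (by omega))).ne'
    obtain ⟨w, hw, hDw⟩ := intermediate_value_Icc' hr1.le hc ⟨hD1, hDr.le⟩
    have hrw : r < w := hw.1.lt_of_ne fun h => hDr.ne' (h ▸ hDw)
    refine hF.exists_disclosureForm h0 hr hrw le_rfl hw.2 (Or.inl rfl) ?_
    simpa [hD] using hDw
  · set κ := ((n : ℝ) - 1) / n * (F 1 ^ n - F vL ^ n) / (F 1 ^ (n - 1) - F vL ^ (n - 1)) with hκ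
    set E : ℝ → ℝ := fun s => (∫ v in vL..1, F v) - F vL * (r - vL) -
      ((s - r) * κ + (1 - s) * F 1) with hE
    have hEr : E r < 0 := by
      simp only [hE, sub_self, zero_mul, hF.one]
      linarith
    have hE1 : 0 ≤ E 1 := by
      simpa [hE, hκ, hD] using hD1.le
    have hc : ContinuousOn E (Icc r 1) := by fun_prop
    obtain ⟨s, hs, hEs⟩ := intermediate_value_Icc hr1.le hc ⟨hEr.le, hE1⟩
    have hrs : r < s := hs.1.lt_of_ne fun h => hEr.ne (h ▸ hEs)
    exact hF.exists_disclosureForm h0 hr hrs hs.2 le_rfl (Or.inr rfl) hEs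

/-- Equilibrium Candidates. Fix `r ∈ (0,1)` and `v_L ∈ [0, r)`. A
distribution `G` that is an MPC of `F`, touches `F` at `v_H`, and has the disclosure form
with parameters `(v_L, v_H, β, r)` for some `v_H ∈ (r,1]`, `β > 0`, exists iff
`E_F[v | v > v_L] > r`.  When it exists it is unique on `[0,1]`, and its slope satisfies
`β = (E_F[F(v)^{n-1} | v ∈ (v_L,v_H)] - F(v_L)^{n-1}) / (E_F[v | v ∈ (v_L,v_H)] - r)`. -/
theorem stmt4 (F f : ℝ → ℝ) (n : ℕ)
    (hf_cont : ContinuousOn f (Set.Icc 0 1))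
    (hf_pos : ∀ v ∈ Set.Icc (0 : ℝ) 1, 0 < f v)
    (hF : ∀ z ∈ Set.Icc (0 : ℝ) 1, F z = ∫ t in (0 : ℝ)..z, f t)
    (hF1 : F 1 = 1)
    (hn : 2 ≤ n)
    (hconv : ConvexOn ℝ (Set.Icc (0 : ℝ) 1) fun v => F v ^ (n - 1))
    (r vL : ℝ) (hr : r ∈ Set.Ioo (0 : ℝ) 1) (hvL : vL ∈ Set.Ico (0 : ℝ) r) :
    ((∃ G : ℝ → ℝ, ∃ vH β : ℝ, MPCof G F ∧ G vH = F vH ∧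
        DisclosureForm F n vL vH β r G) ↔
      r < (∫ v in vL..1, v * f v) / (1 - F vL)) ∧
    (∀ G G' : ℝ → ℝ, ∀ vH vH' β β' : ℝ,
      MPCof G F → G vH = F vH → DisclosureForm F n vL vH β r G →
      MPCof G' F → G' vH' = F vH' → DisclosureForm F n vL vH' β' r G' →
      ∀ v ∈ Set.Icc (0 : ℝ) 1, G v = G' v) ∧
    (∀ G : ℝ → ℝ, ∀ vH β : ℝ,
      MPCof G F → G vH = F vH → DisclosureForm F n vL vH β r G →
      β = ((∫ v in vL..vH, F v ^ (n - 1) * f v) / (F vH - F vL) - F vL ^ (n - 1)) /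
          ((∫ v in vL..vH, v * f v) / (F vH - F vL) - r)) := by
  have hC := ConvexPowCDF.of_density hf_cont hf_pos hF hF1 hn hconv
  have hvL1 : vL < 1 := hvL.2.trans hr.2
  have hmean := integral_id_mul_density hf_cont hF hvL.1 hvL1.le le_rfl
  have hd : 0 < 1 - F vL := by
    have := hC.lt hvL.1 hvL1 le_rfl
    linarith
  refine ⟨⟨?_, fun h => ?_⟩, ?_, ?_⟩
  · rintro ⟨G, vH, β, hM, ht, hG⟩
    rw [lt_div_iff₀ hd, hmean, hF1]
    obtain ⟨h0, hr', hrH, hH, hβ, -⟩ := id hG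
    have h1 := hG.integral_mid_lt hC ht
    have h2 := (hG.integral_sub hC ht).symm.trans hM.2
    have h3 : ∫ v in vH..1, F v ≤ ∫ v in vH..1, (1 : ℝ) :=
      intervalIntegral.integral_mono_on hH (hC.intervalIntegrable (by linarith) hH le_rfl)
        intervalIntegrable_const fun v hv => hC.le_one (by linarith [hv.1]) hv.2
    rw [intervalIntegral.integral_const, smul_eq_mul] at h3
    rw [← intervalIntegral.integral_add_adjacent_intervals
      (hC.intervalIntegrable h0 (by linarith) hH) (hC.intervalIntegrable (by linarith) hH le_rfl)]
    have h4 := mul_le_mul_of_nonneg_right (hC.le_one (by linarith) hH) (sub_nonneg.2 hrH.le)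
    linarith
  · rw [lt_div_iff₀ hd, hmean, hF1] at h
    exact hC.exists_disclosureForm_of_integral_lt hvL.1 hvL.2 hr.2 (by linarith)
  · intro G G' vH vH' β β' hM ht hG hM' ht' hG'
    exact DisclosureForm.eqOn hC hG ht hM.2 hG' ht' hM'.2
  · intro G vH β hM ht hG
    obtain ⟨h0, hr', hrH, hH, hβ, -⟩ := id hG
    have hB : 0 < F vH - F vL := sub_pos.2 (hC.lt h0 (by linarith) hH)
    have h1 := hG.integral_mid_lt hC ht
    have h2 := (hG.integral_sub hC ht).symm.trans hM.2
    have h3 := hG.mul_integral_mid hC ht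
    have hn0 : (n : ℝ) ≠ 0 := by positivity
    rw [integral_pow_mul_density hn hf_cont hF h0 (by linarith) hH,
      integral_id_mul_density hf_cont hF h0 (by linarith) hH]
    set I := ∫ v in vL..vH, F v
    set J := ∫ v in r..vH, G v
    have hQ : 0 < vH * F vH - vL * F vL - I - r * (F vH - F vL) := by linarith
    rw [div_sub' hB.ne', div_sub' hB.ne', div_div_div_cancel_right₀ hB.ne', eq_div_iff (by linarith)]
    have hb : F vH ^ n = F vH ^ (n - 1) * F vH := by rw [← pow_succ]; congr 1; omega
    have ha : F vL ^ n = F vL ^ (n - 1) * F vL := by rw [← pow_succ]; congr 1; omega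
    have hdiv : ((n : ℝ) - 1) / n = 1 - 1 / n := by field_simp
    rw [hdiv] at h3
    linear_combination (-β) * h2 - h3 - hb + ha
end

section
/- Fix r ∈ (0, μ). For each integer n ≥ 2 let β_n > 0 be the unique slope such that for some v_H(n) ∈ (r, 1] the disclosure form with parameters (0, v_H(n), β_n, r) is an MPC of F and its value at v_H(n) equals F(v_H(n)) (such β_n exists and is unique because E_F[v] = μ > r). Then the sequences n ↦ β_n and n ↦ n·β_n are weakly decreasing, and lim_{n→∞} β_n = lim_{n→∞} n·β_n = 0. -/
open MeasureTheory Set Filter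

/-- The clipped affine function `v ↦ min (max (β (v - r)) 0) 1`, raised to the power `p`. -/
noncomputable def ramp (β r p v : ℝ) : ℝ := (min (max (β * (v - r)) 0) 1) ^ p

lemma continuous_ramp (β r : ℝ) {p : ℝ} (hp : 0 ≤ p) : Continuous (ramp β r p) := by
  unfold ramp
  exact Continuous.rpow_const (by fun_prop) (fun _ => Or.inr hp)

lemma monotone_ramp {β : ℝ} (hβ : 0 ≤ β) (r : ℝ) {p : ℝ} (hp : 0 ≤ p) :
    Monotone (ramp β r p) := by
  intro a b hab
  unfold ramp
  gcongr

lemma ramp_of_le {β r p v : ℝ} (hβ : 0 ≤ β) (hp : p ≠ 0) (hv : v ≤ r) : ramp β r p v = 0 := by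
  have h : β * (v - r) ≤ 0 := mul_nonpos_of_nonneg_of_nonpos hβ (by linarith)
  simp [ramp, max_eq_right h, Real.zero_rpow hp]

lemma ramp_of_ge {β r p v : ℝ} (hβ : 0 ≤ β) (hv : r ≤ v) :
    ramp β r p v = (min (β * (v - r)) 1) ^ p := by
  have h : 0 ≤ β * (v - r) := mul_nonneg hβ (by linarith)
  simp [ramp, max_eq_left h]

lemma ramp_pow_le {β r : ℝ} {m : ℕ} (hm : m ≠ 0) (v : ℝ) :
    ramp β r (m : ℝ)⁻¹ v ^ m ≤ max (β * (v - r)) 0 := by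
  rw [ramp, Real.rpow_inv_natCast_pow (by positivity) hm]
  exact min_le_left _ _

lemma ramp_add_pow_div {β r U : ℝ} {m : ℕ} (hm : m ≠ 0) (hβ : 0 < β) (hU : U ∈ Icc (0 : ℝ) 1) :
    ramp β r (m : ℝ)⁻¹ (r + U ^ m / β) = U := by
  have hUm : 0 ≤ U ^ m := pow_nonneg hU.1 m
  rw [ramp_of_ge hβ.le (by have := div_nonneg hUm hβ.le; linarith)]
  have : β * (r + U ^ m / β - r) = U ^ m := by field_simp; ring
  rw [this, min_eq_left (pow_le_one₀ hU.1 hU.2), Real.pow_rpow_inv_natCast hU.1 hm]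

lemma integral_ramp {β r U : ℝ} {m : ℕ} (hm : m ≠ 0) (hβ : 0 < β) (hr : 0 ≤ r)
    (hU : U ∈ Icc (0 : ℝ) 1) :
    ∫ v in (0 : ℝ)..(r + U ^ m / β), ramp β r (m : ℝ)⁻¹ v
      = U * (U ^ m / β) - U ^ (m + 1) / ((m + 1) * β) := by
  have hUm : 0 ≤ U ^ m := pow_nonneg hU.1 m
  have hUm1 : U ^ m ≤ 1 := pow_le_one₀ hU.1 hU.2
  have hp : (0 : ℝ) < (m : ℝ)⁻¹ := by positivity
  have hm' : (0 : ℝ) < m := by positivity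
  have ht : r ≤ r + U ^ m / β := by have := div_nonneg hUm hβ.le; linarith
  have hint := (continuous_ramp β r hp.le).intervalIntegrable (μ := volume)
  rw [← intervalIntegral.integral_add_adjacent_intervals (hint 0 r) (hint r _)]
  have h0 : ∫ v in (0 : ℝ)..r, ramp β r (m : ℝ)⁻¹ v = 0 := by
    rw [intervalIntegral.integral_congr (g := fun _ => (0 : ℝ))]
    · simp
    · intro v hv
      rw [uIcc_of_le hr] at hv
      exact ramp_of_le hβ.le hp.ne' hv.2
  have h1 : ∫ v in r..(r + U ^ m / β), ramp β r (m : ℝ)⁻¹ v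
      = ∫ v in r..(r + U ^ m / β), (β * v - β * r) ^ (m : ℝ)⁻¹ := by
    apply intervalIntegral.integral_congr
    intro v hv
    rw [uIcc_of_le ht] at hv
    have : β * (v - r) ≤ U ^ m := by
      calc β * (v - r) ≤ β * (U ^ m / β) := by gcongr; linarith [hv.2]
        _ = U ^ m := by field_simp
    simp only []
    rw [ramp_of_ge hβ.le hv.1, min_eq_left (this.trans hUm1), mul_sub]
  have e : β * (r + U ^ m / β) - β * r = U ^ m := by field_simp; ring
  have hpow : (U ^ m) ^ ((m : ℝ)⁻¹ + 1) = U * U ^ m := by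
    rw [Real.rpow_add_one' hUm (by positivity), Real.pow_rpow_inv_natCast hU.1 hm]
  rw [h0, h1, intervalIntegral.integral_comp_mul_sub (fun y : ℝ => y ^ (m : ℝ)⁻¹) hβ.ne', e, sub_self,
    integral_rpow (Or.inl (by linarith)), hpow, Real.zero_rpow (by positivity), smul_eq_mul]
  field_simp
  ring

/-- Young's inequality for `ramp`. -/
lemma le_integral_ramp {β r U : ℝ} {m : ℕ} (hm : m ≠ 0) (hβ : 0 < β) (hr : 0 ≤ r)
    (hU : U ∈ Icc (0 : ℝ) 1) (z : ℝ) :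
    (z - r) * U - U ^ (m + 1) / ((m + 1) * β) ≤ ∫ v in (0 : ℝ)..z, ramp β r (m : ℝ)⁻¹ v := by
  have hp : (0 : ℝ) ≤ (m : ℝ)⁻¹ := by positivity
  set t := r + U ^ m / β with ht
  have hint := (continuous_ramp β r hp).intervalIntegrable (μ := volume)
  have hval := ramp_add_pow_div (r := r) hm hβ hU
  have hmono := monotone_ramp hβ.le r hp
  have h : U * (z - t) ≤ ∫ v in t..z, ramp β r (m : ℝ)⁻¹ v := by
    rcases le_total t z with htz | htz
    · have := intervalIntegral.integral_mono_on (μ := volume) htz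
        (intervalIntegrable_const (c := U)) (hint t z)
        (fun v hv => hval ▸ hmono hv.1)
      simpa [mul_comm] using this
    · have := intervalIntegral.integral_mono_on (μ := volume) htz
        (hint z t) (intervalIntegrable_const (c := U))
        (fun v hv => (hmono hv.2).trans hval.le)
      rw [intervalIntegral.integral_symm]
      simp at this
      linarith
  rw [← intervalIntegral.integral_add_adjacent_intervals (hint 0 t) (hint t z),
    integral_ramp hm hβ hr hU]
  rw [ht] at h ⊢
  linarith

/-- The equality case of Young's inequality for `ramp`. -/
lemma integral_ramp_le {β r : ℝ} {m : ℕ} (hm : m ≠ 0) (hβ : 0 < β) (hr : 0 ≤ r) {z : ℝ}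
    (hz : r ≤ z) :
    ∫ v in (0 : ℝ)..z, ramp β r (m : ℝ)⁻¹ v ≤
      (z - r) * ramp β r (m : ℝ)⁻¹ z - ramp β r (m : ℝ)⁻¹ z ^ (m + 1) / ((m + 1) * β) := by
  have hp : (0 : ℝ) ≤ (m : ℝ)⁻¹ := by positivity
  set U := ramp β r (m : ℝ)⁻¹ z with hUdef
  have hU : U ∈ Icc (0 : ℝ) 1 := by
    refine ⟨by rw [hUdef, ramp]; positivity, ?_⟩
    rw [hUdef, ramp]
    exact Real.rpow_le_one (by positivity) (min_le_right _ _) hp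
  set t := r + U ^ m / β with ht
  have hint := (continuous_ramp β r hp).intervalIntegrable (μ := volume)
  have htz : t ≤ z := by
    have h1 := ramp_pow_le (β := β) (r := r) hm z
    rw [← hUdef, max_eq_left (mul_nonneg hβ.le (by linarith))] at h1
    have : U ^ m / β ≤ z - r := by rw [div_le_iff₀ hβ]; linarith
    linarith
  have h := intervalIntegral.integral_mono_on (μ := volume) htz
    (hint t z) (intervalIntegrable_const (c := U))
    (fun v hv => monotone_ramp hβ.le r hp hv.2)
  simp at h
  rw [← intervalIntegral.integral_add_adjacent_intervals (hint 0 t) (hint t z),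
    integral_ramp hm hβ hr hU]
  rw [ht] at h ⊢
  linarith

/-- If the affine piece of slope `β` touches `F` at `w` with equal integrals up to `w`, then
it stays below `F` after `w`. -/
lemma ramp_le_of_touch {F : ℝ → ℝ} {β r w : ℝ} {m : ℕ} (hm : m ≠ 0) (hβ : 0 < β) (hr : 0 < r)
    (hcont : ContinuousOn F (Icc 0 1)) (hmono : StrictMonoOn F (Icc 0 1)) (hF0 : F 0 = 0)
    (hF1 : F 1 = 1) (hconv : ConvexOn ℝ (Icc (0 : ℝ) 1) F) (hrw : r < w) (hw1 : w ≤ 1)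
    (htouch : ramp β r (m : ℝ)⁻¹ w = F w)
    (hint : ∫ v in (0 : ℝ)..w, (F v - ramp β r (m : ℝ)⁻¹ v) = 0)
    {v : ℝ} (hwv : w < v) (hv1 : v ≤ 1) : ramp β r (m : ℝ)⁻¹ v ≤ F v := by
  have hp : (0 : ℝ) < (m : ℝ)⁻¹ := by positivity
  have hnn : ∀ x ∈ Icc (0 : ℝ) 1, 0 ≤ F x := fun x hx =>
    hF0 ▸ hmono.monotoneOn ⟨le_rfl, zero_le_one⟩ hx hx.1
  have ramp_le : ∀ x ∈ Icc (0 : ℝ) 1, r ≤ x → β * (x - r) ≤ F x ^ m →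
      ramp β r (m : ℝ)⁻¹ x ≤ F x := by
    intro x hx hrx h
    rw [ramp_of_ge hβ.le hrx]
    calc _ ≤ (F x ^ m) ^ (m : ℝ)⁻¹ := by
          apply Real.rpow_le_rpow _ ((min_le_left _ _).trans h) hp.le
          have := mul_nonneg hβ.le (sub_nonneg.2 hrx)
          positivity
      _ = F x := Real.pow_rpow_inv_natCast (hnn x hx) hm
  have hwI : w ∈ Icc (0 : ℝ) 1 := ⟨by linarith, hw1⟩
  have hvI : v ∈ Icc (0 : ℝ) 1 := ⟨by linarith, hv1⟩
  have hFw : F w < 1 := hF1 ▸ hmono hwI ⟨zero_le_one, le_rfl⟩ (by linarith)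
  have hbase : β * (w - r) = F w ^ m := by
    have hb : 0 ≤ β * (w - r) := mul_nonneg hβ.le (by linarith)
    have h : min (β * (w - r)) 1 = F w ^ m := by
      rw [← htouch, ramp_of_ge hβ.le hrw.le, Real.rpow_inv_natCast_pow (by positivity) hm]
    have h2 : F w ^ m < 1 := pow_lt_one₀ (hnn w hwI) hFw hm
    rcases min_cases (β * (w - r)) 1 with h3 | h3 <;> linarith
  by_contra! hlt
  have hD : F v ^ m < β * (v - r) := by
    by_contra! h
    exact hlt.not_ge (ramp_le v hvI (by linarith) h)
  have hpow : ConvexOn ℝ (Icc (0 : ℝ) 1) (F ^ m) := hconv.pow (fun {x} hx => hnn x hx) m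
  have hbelow : ∀ x ∈ Icc (0 : ℝ) w, ramp β r (m : ℝ)⁻¹ x ≤ F x := by
    intro x hx
    have hxI : x ∈ Icc (0 : ℝ) 1 := ⟨hx.1, hx.2.trans hw1⟩
    rcases le_total x r with hxr | hxr
    · rw [ramp_of_le hβ.le hp.ne' hxr]
      exact hnn x hxI
    · apply ramp_le x hxI hxr
      rcases hx.2.eq_or_lt with rfl | hxw
      · exact hbase.le
      · by_contra! hneg
        have h := hpow.slope_mono_adjacent hxI hvI hxw hwv
        simp only [Pi.pow_apply] at h
        have h1 : β < (F w ^ m - F x ^ m) / (w - x) := by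
          rw [lt_div_iff₀ (by linarith)]; nlinarith
        have h2 : (F v ^ m - F w ^ m) / (v - w) < β := by
          rw [div_lt_iff₀ (by linarith)]; nlinarith
        linarith
  have hc : ContinuousOn (fun x => F x - ramp β r (m : ℝ)⁻¹ x) (Icc 0 w) :=
    (hcont.mono (Icc_subset_Icc_right hw1)).sub (continuous_ramp β r hp.le).continuousOn
  have hpos := intervalIntegral.integral_pos (by linarith) hc
    (fun x hx => sub_nonneg.2 (hbelow x ⟨hx.1.le, hx.2⟩))
    ⟨r, ⟨hr.le, hrw.le⟩, by
      rw [ramp_of_le hβ.le hp.ne' le_rfl, sub_zero, ← hF0]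
      exact hmono ⟨le_rfl, zero_le_one⟩ ⟨hr.le, by linarith⟩ hr⟩
  linarith

/-- The mean-preserving contraction condition for a disclosure form with `v_L = 0`, expressed
through the dual description of the affine piece. -/
lemma disclosureForm_dual {F G : ℝ → ℝ} {β r w : ℝ} {m : ℕ} (hm : m ≠ 0) (hr : 0 < r)
    (hcont : ContinuousOn F (Icc 0 1)) (hmono : StrictMonoOn F (Icc 0 1)) (hF0 : F 0 = 0)
    (hF1 : F 1 = 1) (hconv : ConvexOn ℝ (Icc (0 : ℝ) 1) F)
    (hG : MPCof G F) (htouch : G w = F w) (hform : DisclosureForm F (m + 1) 0 w β r G) :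
    (∀ z ∈ Icc (0 : ℝ) 1, ∀ U ∈ Icc (0 : ℝ) 1,
      ((m + 1 : ℕ) * β) * ((z - r) * U - ∫ v in (0 : ℝ)..z, F v) ≤ U ^ (m + 1)) ∧
    ∃ z ∈ Icc (0 : ℝ) 1, ∃ U ∈ Ioc (0 : ℝ) 1,
      U ^ (m + 1) ≤ ((m + 1 : ℕ) * β) * ((z - r) * U - ∫ v in (0 : ℝ)..z, F v) := by
  obtain ⟨-, -, hrw, hw1, hβ, hG0, hGgap, hGmid, hGtop⟩ := hform
  have hp : (0 : ℝ) < (m : ℝ)⁻¹ := by positivity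
  have hwI : w ∈ Icc (0 : ℝ) 1 := ⟨by linarith, hw1⟩
  have hGramp : ∀ v ∈ Icc (0 : ℝ) w, G v = ramp β r (m : ℝ)⁻¹ v := by
    intro v hv
    rcases lt_or_ge v r with hvr | hvr
    · rw [ramp_of_le hβ.le hp.ne' hvr.le]
      rcases hv.1.eq_or_lt with rfl | h0
      · rw [hG0 0 le_rfl, hF0]
      · rw [hGgap v h0 hvr, hF0]
    · rw [hGmid v hvr hv.2, ramp_of_ge hβ.le hvr, hF0]
      simp [hm]
  have hFi : ∀ a ∈ Icc (0 : ℝ) 1, ∀ b ∈ Icc (0 : ℝ) 1, IntervalIntegrable F volume a b :=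
    fun a ha b hb => (hcont.mono (uIcc_subset_Icc ha hb)).intervalIntegrable
  have hRi := (continuous_ramp β r hp.le).intervalIntegrable (μ := volume)
  have h0I : (0 : ℝ) ∈ Icc (0 : ℝ) 1 := ⟨le_rfl, zero_le_one⟩
  have h1I : (1 : ℝ) ∈ Icc (0 : ℝ) 1 := ⟨zero_le_one, le_rfl⟩
  have hcongr : ∀ z ∈ Icc (0 : ℝ) w, ∫ v in (0 : ℝ)..z, (F v - G v)
      = ∫ v in (0 : ℝ)..z, (F v - ramp β r (m : ℝ)⁻¹ v) := by
    intro z hz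
    apply intervalIntegral.integral_congr
    intro v hv
    rw [uIcc_of_le hz.1] at hv
    simp only [hGramp v ⟨hv.1, hv.2.trans hz.2⟩]
  have hle : ∀ z ∈ Icc (0 : ℝ) w,
      ∫ v in (0 : ℝ)..z, ramp β r (m : ℝ)⁻¹ v ≤ ∫ v in (0 : ℝ)..z, F v := by
    intro z hz
    have h := hG.1 z ⟨hz.1, hz.2.trans hw1⟩
    rw [hcongr z hz, intervalIntegral.integral_sub
      (hFi 0 h0I z ⟨hz.1, hz.2.trans hw1⟩) (hRi 0 z)] at h
    linarith
  have hzero : ∫ v in (0 : ℝ)..w, (F v - ramp β r (m : ℝ)⁻¹ v) = 0 := by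
    rw [← hcongr w ⟨hwI.1, le_rfl⟩]
    have htail : ∀ v ∈ uIoc w 1, (0 : ℝ) = F v - G v := by
      intro v hv
      rw [uIoc_of_le hw1] at hv
      rw [hGtop v hv.1 hv.2, sub_self]
    have hti : IntervalIntegrable (fun v => F v - G v) volume w 1 :=
      (intervalIntegrable_const (c := (0 : ℝ))).congr htail
    have hhi : IntervalIntegrable (fun v => F v - G v) volume 0 w := by
      refine ((hFi 0 h0I w hwI).sub (hRi 0 w)).congr ?_
      intro v hv
      rw [uIoc_of_le hwI.1] at hv
      simp only [hGramp v ⟨hv.1.le, hv.2⟩]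
    have h := hG.2
    rw [← intervalIntegral.integral_add_adjacent_intervals hhi hti] at h
    have ht0 : ∫ v in w..1, (F v - G v) = 0 := by
      rw [intervalIntegral.integral_congr_ae (g := fun _ => (0 : ℝ))
        (Eventually.of_forall fun v hv => (htail v hv).symm)]
      simp
    linarith
  have htouch' : ramp β r (m : ℝ)⁻¹ w = F w := by
    rw [← hGramp w ⟨hwI.1, le_rfl⟩, htouch]
  have hall : ∀ z ∈ Icc (0 : ℝ) 1,
      ∫ v in (0 : ℝ)..z, ramp β r (m : ℝ)⁻¹ v ≤ ∫ v in (0 : ℝ)..z, F v := by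
    intro z hz
    rcases le_total z w with hzw | hzw
    · exact hle z ⟨hz.1, hzw⟩
    · rw [← intervalIntegral.integral_add_adjacent_intervals (hRi 0 w) (hRi w z),
        ← intervalIntegral.integral_add_adjacent_intervals (hFi 0 h0I w hwI) (hFi w hwI z hz)]
      refine add_le_add (hle w ⟨hwI.1, le_rfl⟩) ?_
      apply intervalIntegral.integral_mono_on hzw (hRi w z) (hFi w hwI z hz)
      intro v hv
      rcases hv.1.eq_or_lt with rfl | hwv
      · exact htouch'.le
      · exact ramp_le_of_touch hm hβ hr hcont hmono hF0 hF1 hconv hrw hw1 htouch' hzero hwv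
          (hv.2.trans hz.2)
  have hb : (0 : ℝ) < (m + 1) * β := by positivity
  push_cast
  refine ⟨fun z hz U hU => ?_, w, hwI, F w, ⟨?_, ?_⟩, ?_⟩
  · have h := (le_integral_ramp hm hβ hr.le hU z).trans (hall z hz)
    rw [mul_comm, ← le_div_iff₀ hb]
    linarith
  · rw [← hF0]
    exact hmono h0I hwI (by linarith)
  · rw [← hF1]
    exact hmono.monotoneOn hwI h1I hw1
  · have h := integral_ramp_le hm hβ hr.le hrw.le
    rw [htouch'] at h
    rw [intervalIntegral.integral_sub (hFi 0 h0I w hwI) (hRi 0 w)] at hzero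
    rw [mul_comm, ← div_le_iff₀ hb]
    linarith

/-- Regularity of a distribution function with continuous positive density, and the formula
for the integral of the distribution function in terms of the mean. -/
lemma cdf_of_density {F f : ℝ → ℝ} (hf_cont : ContinuousOn f (Icc 0 1))
    (hf_pos : ∀ v ∈ Icc (0 : ℝ) 1, 0 < f v)
    (hF : ∀ z ∈ Icc (0 : ℝ) 1, F z = ∫ t in (0 : ℝ)..z, f t) :
    ContinuousOn F (Icc 0 1) ∧ StrictMonoOn F (Icc 0 1) ∧
      ∫ v in (0 : ℝ)..1, F v = F 1 - ∫ v in (0 : ℝ)..1, v * f v := by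
  set g : ℝ → ℝ := IccExtend zero_le_one ((Icc (0 : ℝ) 1).domRestrict f) with hg
  have hgc : Continuous g := by
    rw [hg, continuous_IccExtend_iff]
    exact continuousOn_iff_continuous_domRestrict.1 hf_cont
  have hgf : ∀ v ∈ Icc (0 : ℝ) 1, g v = f v := fun v hv => by
    rw [hg, IccExtend_of_mem _ _ hv]; rfl
  set P : ℝ → ℝ := fun z => ∫ t in (0 : ℝ)..z, g t with hP
  have hPF : ∀ z ∈ Icc (0 : ℝ) 1, F z = P z := by
    intro z hz
    rw [hF z hz]
    apply intervalIntegral.integral_congr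
    intro v hv
    rw [uIcc_of_le hz.1] at hv
    exact (hgf v ⟨hv.1, hv.2.trans hz.2⟩).symm
  have hPd : ∀ z, HasDerivAt P (g z) z := fun z => hgc.integral_hasStrictDerivAt 0 z |>.hasDerivAt
  have hPc : Continuous P := continuous_iff_continuousAt.2 fun z => (hPd z).continuousAt
  refine ⟨hPc.continuousOn.congr hPF, ?_, ?_⟩
  · refine StrictMonoOn.congr ?_ (fun z hz => (hPF z hz).symm)
    apply strictMonoOn_of_deriv_pos (convex_Icc 0 1) hPc.continuousOn
    intro x hx
    have hx' := interior_subset hx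
    rw [(hPd x).deriv, hgf x hx']
    exact hf_pos x hx'
  · have h := intervalIntegral.integral_mul_deriv_eq_deriv_mul (a := 0) (b := 1)
      (u := fun x : ℝ => x) (v := P) (u' := fun _ => 1) (v' := g)
      (fun x _ => hasDerivAt_id x) (fun x _ => hPd x) (by simp)
      (hgc.intervalIntegrable 0 1)
    have e1 : ∫ v in (0 : ℝ)..1, v * f v = ∫ v in (0 : ℝ)..1, v * g v := by
      apply intervalIntegral.integral_congr
      intro v hv
      rw [uIcc_of_le zero_le_one] at hv
      simp only [hgf v hv]
    have e2 : ∫ v in (0 : ℝ)..1, F v = ∫ v in (0 : ℝ)..1, P v := by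
      apply intervalIntegral.integral_congr
      intro v hv
      rw [uIcc_of_le zero_le_one] at hv
      exact hPF v hv
    rw [e1, e2, h, hPF 1 ⟨zero_le_one, le_rfl⟩]
    simp

/-- Vanishing slope `β_n`. Fix `r ∈ (0, μ)` and for each `n ≥ 2` let
`β_n > 0` be the unique slope such that for some `v_H(n) ∈ (r, 1]` the disclosure form with
parameters `(0, v_H(n), β_n, r)` is an MPC of `F` touching `F` at `v_H(n)`. Then `β_n` and
`n β_n` are weakly decreasing in `n`, and both tend to `0` as `n → ∞`. -/
theorem stmt19 (F f : ℝ → ℝ) (μ : ℝ)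
    (hf_cont : ContinuousOn f (Set.Icc 0 1))
    (hf_pos : ∀ v ∈ Set.Icc (0 : ℝ) 1, 0 < f v)
    (hF : ∀ z ∈ Set.Icc (0 : ℝ) 1, F z = ∫ t in (0 : ℝ)..z, f t)
    (hF1 : F 1 = 1)
    (hμ : μ = ∫ v in (0 : ℝ)..1, v * f v)
    (hFconv : ConvexOn ℝ (Set.Icc (0 : ℝ) 1) F)
    (r : ℝ) (hr : r ∈ Set.Ioo (0 : ℝ) μ)
    (βn vHn : ℕ → ℝ)
    (hpair : ∀ n : ℕ, 2 ≤ n → 0 < βn n ∧ r < vHn n ∧ vHn n ≤ 1 ∧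
      ∃ G : ℝ → ℝ, MPCof G F ∧ G (vHn n) = F (vHn n) ∧
        DisclosureForm F n 0 (vHn n) (βn n) r G) :
    (∀ n n' : ℕ, 2 ≤ n → n ≤ n' → βn n' ≤ βn n) ∧
    (∀ n n' : ℕ, 2 ≤ n → n ≤ n' → (n' : ℝ) * βn n' ≤ (n : ℝ) * βn n) ∧
    Filter.Tendsto βn Filter.atTop (nhds 0) ∧
    Filter.Tendsto (fun n : ℕ => (n : ℝ) * βn n) Filter.atTop (nhds 0) := by
  obtain ⟨hcont, hmono, hmean⟩ := cdf_of_density hf_cont hf_pos hF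
  have hF0 : F 0 = 0 := by rw [hF 0 ⟨le_rfl, zero_le_one⟩]; simp
  have hdual : ∀ n : ℕ, 2 ≤ n →
      (∀ z ∈ Icc (0 : ℝ) 1, ∀ U ∈ Icc (0 : ℝ) 1,
        (n * βn n) * ((z - r) * U - ∫ v in (0 : ℝ)..z, F v) ≤ U ^ n) ∧
      ∃ z ∈ Icc (0 : ℝ) 1, ∃ U ∈ Ioc (0 : ℝ) 1,
        U ^ n ≤ (n * βn n) * ((z - r) * U - ∫ v in (0 : ℝ)..z, F v) := by
    intro n hn
    obtain ⟨-, -, -, G, hG, htouch, hform⟩ := hpair n hn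
    obtain ⟨m, rfl⟩ : ∃ m, n = m + 1 := ⟨n - 1, by omega⟩
    exact disclosureForm_dual (by omega) hr.1 hcont hmono hF0 hF1 hFconv hG htouch hform
  have hbpos : ∀ n : ℕ, 2 ≤ n → 0 < (n : ℝ) * βn n := fun n hn =>
    mul_pos (by positivity) (hpair n hn).1
  have hanti : ∀ n n' : ℕ, 2 ≤ n → n ≤ n' → (n' : ℝ) * βn n' ≤ (n : ℝ) * βn n := by
    intro n n' hn hnn'
    obtain ⟨z, hz, U, hU, hge⟩ := (hdual n hn).2
    have hle := (hdual n' (hn.trans hnn')).1 z hz U ⟨hU.1.le, hU.2⟩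
    have hpow : U ^ n' ≤ U ^ n := pow_le_pow_of_le_one hU.1.le hU.2 hnn'
    have hc : 0 < (z - r) * U - ∫ v in (0 : ℝ)..z, F v :=
      (mul_pos_iff_of_pos_left (hbpos n hn)).1 ((pow_pos hU.1 n).trans_le hge)
    exact le_of_mul_le_mul_right (hle.trans (hpow.trans hge)) hc
  obtain ⟨z, hz, hc⟩ : ∃ z ∈ Ioo (0 : ℝ) 1, 0 < (z - r) * F z - ∫ v in (0 : ℝ)..z, F v := by
    have hA : ContinuousOn (fun z => ∫ v in (0 : ℝ)..z, F v) (Icc 0 1) := by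
      have h := intervalIntegral.continuousOn_primitive_interval (μ := volume)
        (a := (0 : ℝ)) (b := 1) (f := F)
        (by rw [uIcc_of_le zero_le_one]; exact hcont.integrableOn_Icc)
      rwa [uIcc_of_le zero_le_one] at h
    have hC : ContinuousOn (fun z => (z - r) * F z - ∫ v in (0 : ℝ)..z, F v) (Icc 0 1) :=
      ((continuousOn_id.sub continuousOn_const).mul hcont).sub hA
    have h1 : 0 < (1 - r) * F 1 - ∫ v in (0 : ℝ)..1, F v := by
      rw [hmean, hF1, ← hμ]; linarith [hr.2]
    have hev : ∀ᶠ z in nhdsWithin (1 : ℝ) (Ioo 0 1),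
        0 < (z - r) * F z - ∫ v in (0 : ℝ)..z, F v :=
      ((hC 1 ⟨zero_le_one, le_rfl⟩).mono Ioo_subset_Icc_self).eventually_const_lt h1
    have : (nhdsWithin (1 : ℝ) (Ioo 0 1)).NeBot := right_nhdsWithin_Ioo_neBot zero_lt_one
    obtain ⟨z, h, hz⟩ := (hev.and self_mem_nhdsWithin).exists
    exact ⟨z, hz, h⟩
  have hzI : z ∈ Icc (0 : ℝ) 1 := ⟨hz.1.le, hz.2.le⟩
  have hU0 : 0 ≤ F z := hF0 ▸ hmono.monotoneOn ⟨le_rfl, zero_le_one⟩ hzI hz.1.le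
  have hU1 : F z < 1 := hF1 ▸ hmono hzI ⟨zero_le_one, le_rfl⟩ hz.2
  have hlim : Tendsto (fun n : ℕ => (n : ℝ) * βn n) atTop (nhds 0) := by
    have hgeom := (tendsto_pow_atTop_nhds_zero_of_lt_one hU0 hU1).div_const
      ((z - r) * F z - ∫ v in (0 : ℝ)..z, F v)
    rw [zero_div] at hgeom
    refine tendsto_of_tendsto_of_tendsto_of_le_of_le' tendsto_const_nhds hgeom ?_ ?_
    · filter_upwards [eventually_ge_atTop 2] with n hn using (hbpos n hn).le
    · filter_upwards [eventually_ge_atTop 2] with n hn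
      rw [le_div_iff₀ hc]
      exact (hdual n hn).1 z hzI (F z) ⟨hU0, hU1.le⟩
  refine ⟨fun n n' hn hnn' => ?_, hanti, ?_, hlim⟩
  · have h : (n : ℝ) * βn n' ≤ n * βn n :=
      (mul_le_mul_of_nonneg_right (Nat.cast_le.2 hnn') (hpair n' (hn.trans hnn')).1.le).trans
        (hanti n n' hn hnn')
    exact le_of_mul_le_mul_left h (by positivity)
  · refine tendsto_of_tendsto_of_tendsto_of_le_of_le' tendsto_const_nhds hlim ?_ ?_
    · filter_upwards [eventually_ge_atTop 2] with n hn using (hpair n hn).1.le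
    · filter_upwards [eventually_ge_atTop 2] with n hn
      exact le_mul_of_one_le_left (hpair n hn).1.le (by exact_mod_cast (by omega : 1 ≤ n))
end
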